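/- Fix t > 0. For every n ∈ ℕ and every r ∈ ℤ the doubly infinite sum Σ_{k∈ℤ} t^k·q^{k(k+1)/2}·S_n(t q^k;q)·M_r^{(t)}(t q^k;q) converges absolutely and equals 0; that is, the Stieltjes–Wigert polynomials and the q-Bessel functions M_r^{(t)}(·;q) are mutually orthogonal with respect to the discrete measure Σ_{k∈ℤ} t^k q^{k(k+1)/2} δ_{t q^k}. -/

import Mathlib

open Finset

/-- The real q-Pochhammer symbol `(a;q)_n = ∏_{j=0}^{n-1} (1 - a q^j)`. -/
noncomputable def qPochR (q a : ℝ) (n : ℕ) : ℝ :=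
  ∏ j ∈ Finset.range n, (1 - a * q ^ j)

/-- The infinite q-Pochhammer symbol `(a;q)_∞ = ∏_{j=0}^∞ (1 - a q^j)`. -/
noncomputable def qPochInfR (q a : ℝ) : ℝ :=
  ∏' j : ℕ, (1 - a * q ^ j)

/-- The Stieltjes--Wigert polynomial
`S_n(x;q) = (1/(q;q)_n) Σ_{k=0}^n ((q;q)_n/((q;q)_k (q;q)_{n-k})) (-1)^k q^{k²} x^k`. -/
noncomputable def stieltjesWigertR (q : ℝ) (n : ℕ) (x : ℝ) : ℝ :=
  (1 / qPochR q q n) *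
    ∑ k ∈ Finset.range (n + 1),
      (qPochR q q n / (qPochR q q k * qPochR q q (n - k))) * (-1) ^ k * q ^ (k ^ 2) * x ^ k

/-- `φ_z(x) = Σ_{n=0}^∞ (∏_{j=0}^{n-1} (z - q^j)) q^{n(n+1)/2} x^n/(q;q)_n`. -/
noncomputable def phiSWR (q z x : ℝ) : ℝ :=
  ∑' n : ℕ, (∏ j ∈ Finset.range n, (z - q ^ j)) * q ^ (n * (n + 1) / 2) * x ^ n / qPochR q q n

/-- The q-Bessel function `M_r^{(t)}(x;q) = φ_{-q^r/t}(x)/(q;q)_∞`. -/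
noncomputable def qBesselM (q t : ℝ) (r : ℤ) (x : ℝ) : ℝ :=
  phiSWR q (-q ^ r / t) x / qPochInfR q q

open Filter Topology

/-- The entire function `∑_{m ≥ 0} q^{m(m-1)/2} (-w)^m / (q;q)_m`, which is Euler's series for
`(w;q)_∞`. -/
noncomputable def qEulerSeries (q w : ℝ) : ℝ :=
  ∑' m : ℕ, q ^ m.choose 2 * (-w) ^ m / qPochR q q m

/-- The reciprocal `1/(q;q)_s`, extended by zero to negative integers `s`. -/
noncomputable def qPochRecip (q : ℝ) (s : ℤ) : ℝ :=
  if 0 ≤ s then 1 / qPochR q q s.toNat else 0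

lemma qPochR_succ (q a : ℝ) (n : ℕ) : qPochR q a (n + 1) = qPochR q a n * (1 - a * q ^ n) :=
  Finset.prod_range_succ _ _

lemma one_sub_pow_succ_pos {q : ℝ} (hq0 : 0 < q) (hq1 : q < 1) (n : ℕ) : 0 < 1 - q * q ^ n := by
  have := pow_lt_one₀ hq0.le hq1 n.succ_ne_zero
  rw [pow_succ'] at this
  linarith

lemma qPochR_self_pos {q : ℝ} (hq0 : 0 < q) (hq1 : q < 1) (n : ℕ) : 0 < qPochR q q n :=
  Finset.prod_pos fun j _ => one_sub_pow_succ_pos hq0 hq1 j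

lemma choose_two_succ (m : ℕ) : (m + 1).choose 2 = m.choose 2 + m := by
  rw [Nat.choose_succ_succ' m 1, Nat.choose_one_right, add_comm]

lemma choose_two_add (j m : ℕ) : (j + m).choose 2 = j.choose 2 + m.choose 2 + j * m := by
  induction m with
  | zero => simp
  | succ m ih => rw [← add_assoc, choose_two_succ, choose_two_succ, ih]; ring

lemma two_mul_choose_two (m : ℕ) : (2 * m.choose 2 : ℤ) = m * (m - 1) := by
  induction m with
  | zero => simp
  | succ m ih => rw [choose_two_succ]; push_cast; linarith

lemma two_mul_triangular (k : ℤ) : 2 * (k * (k + 1) / 2) = k * (k + 1) :=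
  Int.mul_ediv_cancel' (Int.even_mul_succ_self k).two_dvd

lemma summable_qEuler {q : ℝ} (hq0 : 0 < q) (hq1 : q < 1) (y : ℝ) :
    Summable fun m : ℕ => q ^ m.choose 2 * y ^ m / qPochR q q m := by
  have hlim : Tendsto (fun m : ℕ => q ^ m * |y| / (1 - q * q ^ m)) atTop (𝓝 0) := by
    have h := tendsto_pow_atTop_nhds_zero_of_lt_one hq0.le hq1
    have := (h.mul_const |y|).div ((h.const_mul q).const_sub 1) (by norm_num)
    simpa [Pi.div_def] using this
  refine summable_of_ratio_norm_eventually_le (r := 1 / 2) (by norm_num) ?_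
  filter_upwards [hlim.eventually_le_const (show (0 : ℝ) < 1 / 2 by norm_num)] with m hm
  have h1 := one_sub_pow_succ_pos hq0 hq1 m
  have h2 := qPochR_self_pos hq0 hq1 m
  have key : q ^ (m + 1).choose 2 * y ^ (m + 1) / qPochR q q (m + 1)
      = (q ^ m * y / (1 - q * q ^ m)) * (q ^ m.choose 2 * y ^ m / qPochR q q m) := by
    rw [choose_two_succ, qPochR_succ]
    field_simp
    ring
  rw [key, norm_mul]
  refine mul_le_mul_of_nonneg_right ?_ (norm_nonneg _)
  rwa [Real.norm_eq_abs, abs_div, abs_mul, abs_of_pos h1, abs_of_pos (pow_pos hq0 m)]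

lemma qEulerSeries_eq {q : ℝ} (hq0 : 0 < q) (hq1 : q < 1) (w : ℝ) :
    qEulerSeries q w = (1 - w) * qEulerSeries q (q * w) := by
  have h1 := summable_qEuler hq0 hq1 (-w)
  have h2 := summable_qEuler hq0 hq1 (-(q * w))
  have hdiff : qEulerSeries q w - qEulerSeries q (q * w) = -w * qEulerSeries q (q * w) := by
    unfold qEulerSeries
    rw [← h1.tsum_sub h2, (h1.sub h2).tsum_eq_zero_add, ← tsum_mul_left]
    simp only [Nat.choose_zero_succ, pow_zero, sub_self, zero_add]
    refine tsum_congr fun m => ?_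
    have h1 := (one_sub_pow_succ_pos hq0 hq1 m).ne'
    rw [choose_two_succ, qPochR_succ]
    rw [pow_add, pow_succ, pow_succ, show -(q * w) = q * -w by ring, mul_pow]
    simp only [← div_div]
    calc _ = q ^ m.choose 2 * q ^ m * (-w) ^ m * (-w) / qPochR q q m *
          ((1 - q * q ^ m) / (1 - q * q ^ m)) := by ring
      _ = _ := by rw [div_self h1]; ring
  linarith

lemma qEulerSeries_zpow_neg {q : ℝ} (hq0 : 0 < q) (hq1 : q < 1) (n : ℕ) :
    qEulerSeries q (q ^ (-(n : ℤ))) = 0 := by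
  induction n with
  | zero => rw [qEulerSeries_eq hq0 hq1]; simp
  | succ n ih =>
    rw [qEulerSeries_eq hq0 hq1, ← zpow_one_add₀ hq0.ne']
    have : (1 + -((n + 1 : ℕ) : ℤ)) = -(n : ℤ) := by push_cast; ring
    rw [this, ih, mul_zero]

lemma qEulerSeries_pow_succ {q : ℝ} (hq0 : 0 < q) (hq1 : q < 1) (n : ℕ) :
    qEulerSeries q (q ^ (n + 1)) = qEulerSeries q q / qPochR q q n := by
  induction n with
  | zero => simp [qPochR]
  | succ n ih =>
    have h1 := (one_sub_pow_succ_pos hq0 hq1 n).ne'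
    have h2 := (qPochR_self_pos hq0 hq1 n).ne'
    rw [qEulerSeries_eq hq0 hq1, ← pow_succ', pow_succ' q n] at ih
    rw [qPochR_succ, ← div_div, ← ih, mul_div_cancel_left₀ _ h1]

lemma qEulerSeries_zpow {q : ℝ} (hq0 : 0 < q) (hq1 : q < 1) (s : ℤ) :
    qEulerSeries q (q ^ (s + 1)) = qEulerSeries q q * qPochRecip q s := by
  unfold qPochRecip
  split_ifs with hs
  · lift s to ℕ using hs
    rw [Int.toNat_natCast, mul_one_div, ← qEulerSeries_pow_succ hq0 hq1]
    norm_cast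
  · obtain ⟨n, hn⟩ := Int.eq_ofNat_of_zero_le (show 0 ≤ -(s + 1) by omega)
    rw [show s + 1 = -(n : ℤ) by omega, qEulerSeries_zpow_neg hq0 hq1, mul_zero]

/-- The finite q-binomial theorem. -/
lemma prod_sub_pow_div_qPochR {q : ℝ} (hq0 : 0 < q) (hq1 : q < 1) (z : ℝ) (n : ℕ) :
    (∏ i ∈ Finset.range n, (z - q ^ i)) / qPochR q q n =
      ∑ p ∈ HasAntidiagonal.antidiagonal n,
        ((-1) ^ p.1 * q ^ p.1.choose 2 / qPochR q q p.1) * (z ^ p.2 / qPochR q q p.2) := by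
  induction n with
  | zero => simp [qPochR]
  | succ n ih =>
    have hn := (one_sub_pow_succ_pos hq0 hq1 n).ne'
    have hP := fun m => (qPochR_self_pos hq0 hq1 m).ne'
    rw [Finset.prod_range_succ, qPochR_succ, mul_div_mul_comm, ih, ← mul_div_assoc, div_eq_iff hn,
      mul_sub]
    set a : ℕ → ℝ := fun j => (-1) ^ j * q ^ j.choose 2 / qPochR q q j with ha
    set b : ℕ → ℝ := fun m => z ^ m / qPochR q q m with hb
    have ha' : ∀ j, (1 - q ^ (j + 1)) * a (j + 1) = -(q ^ j * a j) := fun j => by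
      have h1 := (one_sub_pow_succ_pos hq0 hq1 j).ne'
      have := hP j
      simp only [ha, choose_two_succ, qPochR_succ, pow_succ' q j]
      field_simp
      ring
    have hb' : ∀ j, (1 - q ^ (j + 1)) * b (j + 1) = z * b j := fun j => by
      have h1 := (one_sub_pow_succ_pos hq0 hq1 j).ne'
      have := hP j
      simp only [hb, qPochR_succ, pow_succ' q j]
      field_simp
      ring
    have hsplit : (∑ p ∈ HasAntidiagonal.antidiagonal (n + 1), a p.1 * b p.2) * (1 - q * q ^ n)
        = (∑ p ∈ HasAntidiagonal.antidiagonal (n + 1), a p.1 * ((1 - q ^ p.2) * b p.2))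
          + ∑ p ∈ HasAntidiagonal.antidiagonal (n + 1), ((1 - q ^ p.1) * a p.1) * (q ^ p.2 * b p.2) := by
      rw [Finset.sum_mul, ← Finset.sum_add_distrib]
      refine Finset.sum_congr rfl fun p hp => ?_
      rw [← pow_succ', ← HasAntidiagonal.mem_antidiagonal.1 hp, pow_add]
      ring
    refine Eq.trans ?_ hsplit.symm
    rw [Finset.Nat.sum_antidiagonal_succ', Finset.Nat.sum_antidiagonal_succ]
    simp only [ha', hb', pow_zero, sub_self, zero_mul, mul_zero, zero_add]
    rw [Finset.sum_mul, Finset.sum_mul, ← Finset.sum_sub_distrib, ← Finset.sum_add_distrib]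
    refine Finset.sum_congr rfl fun p hp => ?_
    rw [← HasAntidiagonal.mem_antidiagonal.1 hp, pow_add]
    ring

lemma hasSum_phiSWR {q : ℝ} (hq0 : 0 < q) (hq1 : q < 1) (z x : ℝ) :
    HasSum (fun j : ℕ => (-1) ^ j * q ^ (j ^ 2) * x ^ j / qPochR q q j
      * qEulerSeries q (-(x * z * q ^ (j + 1)))) (phiSWR q z x) := by
  let f : ℕ × ℕ → ℝ := fun p => q ^ (p.1 + p.2 + 1).choose 2 * x ^ (p.1 + p.2) *
    (((-1) ^ p.1 * q ^ p.1.choose 2 / qPochR q q p.1) * (z ^ p.2 / qPochR q q p.2))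
  have hfac : ∀ j m, f (j, m) = (-1) ^ j * q ^ (j ^ 2) * x ^ j / qPochR q q j *
      (q ^ m.choose 2 * (-(-(x * z * q ^ (j + 1)))) ^ m / qPochR q q m) := fun j m => by
    have hj : j ^ 2 = j.choose 2 + j + j.choose 2 := by
      have := two_mul_choose_two j
      zify
      linarith
    simp only [f, neg_neg, choose_two_succ, choose_two_add, hj]
    ring
  have hf : Summable f := by
    have h1 := (summable_qEuler hq0 hq1 (q * x)).norm
    have h2 := (summable_qEuler hq0 hq1 (q * x * z)).norm
    refine Summable.of_norm_bounded (h1.mul_of_nonneg h2 (fun _ => norm_nonneg _)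
      fun _ => norm_nonneg _) fun p => ?_
    have hdec : f p = (q ^ (p.1 * p.2) * q ^ p.1.choose 2 * (-1) ^ p.1) *
        ((q ^ p.1.choose 2 * (q * x) ^ p.1 / qPochR q q p.1) *
        (q ^ p.2.choose 2 * (q * x * z) ^ p.2 / qPochR q q p.2)) := by
      simp only [f, choose_two_succ, choose_two_add]
      ring
    rw [hdec, norm_mul, norm_mul (_ / _)]
    refine mul_le_of_le_one_left (by positivity) ?_
    rw [norm_mul, norm_mul, norm_pow (-1 : ℝ), norm_neg, norm_one, one_pow, mul_one,
      norm_pow, norm_pow, Real.norm_of_nonneg hq0.le]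
    exact mul_le_one₀ (pow_le_one₀ hq0.le hq1.le) (by positivity) (pow_le_one₀ hq0.le hq1.le)
  have htot : ∑' p, f p = phiSWR q z x := by
    rw [← HasAntidiagonal.sigmaAntidiagonalEquivProd.tsum_eq f,
      Summable.tsum_sigma' (f := fun c => f (HasAntidiagonal.sigmaAntidiagonalEquivProd c))
        (fun n => (hasSum_fintype fun c : HasAntidiagonal.antidiagonal n => f c).summable)
        (HasAntidiagonal.sigmaAntidiagonalEquivProd.summable_iff.2 hf)]
    unfold phiSWR
    refine tsum_congr fun n => ?_
    rw [mul_assoc, mul_div_right_comm, prod_sub_pow_div_qPochR hq0 hq1, tsum_fintype,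
      Finset.univ_eq_attach, Finset.sum_mul,
      ← Finset.sum_attach (HasAntidiagonal.antidiagonal n)]
    refine Finset.sum_congr rfl fun p _ => ?_
    have hp := HasAntidiagonal.mem_antidiagonal.1 p.2
    simp only [f, HasAntidiagonal.sigmaAntidiagonalEquivProd_apply, hp, Nat.choose_two_right,
      Nat.add_sub_cancel]
    rw [mul_comm (n + 1) n]
    ring
  rw [← htot]
  refine hf.hasSum.prod_fiberwise fun j => ?_
  simp only [hfac]
  exact (summable_qEuler hq0 hq1 _).hasSum.mul_left _

lemma hasSum_phiSWR_lattice {q : ℝ} (hq0 : 0 < q) (hq1 : q < 1) {t : ℝ} (ht : 0 < t) (r k : ℤ) :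
    HasSum (fun j : ℕ => qEulerSeries q q * ((-1) ^ j * q ^ (j ^ 2) * (t * q ^ k) ^ j /
      qPochR q q j * qPochRecip q (k + r + j))) (phiSWR q (-q ^ r / t) (t * q ^ k)) := by
  convert hasSum_phiSWR hq0 hq1 (-q ^ r / t) (t * q ^ k) using 2 with j
  have : -(t * q ^ k * (-q ^ r / t) * q ^ (j + 1)) = q ^ (k + r + j + 1) := by
    rw [zpow_add₀ hq0.ne' _ 1, zpow_add₀ hq0.ne' (k + r), zpow_add₀ hq0.ne' k, zpow_natCast,
      zpow_one, pow_succ]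
    field_simp
  rw [this, qEulerSeries_zpow hq0 hq1]
  ring

lemma hasSum_double_series {q : ℝ} (hq0 : 0 < q) (hq1 : q < 1) {t : ℝ} (ht : 0 < t)
    (i : ℕ) (r : ℤ) :
    HasSum (fun p : ℤ × ℕ => t ^ p.1 * q ^ (p.1 * (p.1 + 1) / 2) * (t * q ^ p.1) ^ i *
      ((-1) ^ p.2 * q ^ (p.2 ^ 2) * (t * q ^ p.1) ^ p.2 / qPochR q q p.2 *
        qPochRecip q (p.1 + r + p.2))) 0 := by
  let e : ℕ × ℕ → ℤ × ℕ := fun p => ((p.1 : ℤ) - p.2 - r, p.2)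
  have he : Function.Injective e := by
    rintro ⟨a, b⟩ ⟨c, d⟩ h
    simp only [e, Prod.mk.injEq] at h ⊢
    omega
  rw [← he.hasSum_iff]
  · have h1 := summable_qEuler hq0 hq1 (t * q ^ (1 - r + i))
    have h2 := summable_qEuler hq0 hq1 (-q ^ (-(i : ℤ)))
    have hs := summable_mul_of_summable_norm h1.norm h2.norm
    have h12 := h1.hasSum.mul h2.hasSum hs
    have h0 := qEulerSeries_zpow_neg hq0 hq1 i
    unfold qEulerSeries at h0
    rw [h0, mul_zero] at h12
    have h := h12.mul_left (t ^ i * t ^ (-r) * q ^ (r * (r - 1) / 2 - i * r))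
    rw [mul_zero] at h
    refine Eq.subst (motive := fun f => HasSum f 0) (Eq.symm (funext ?_)) h
    rintro ⟨l, j⟩
    have hr : 2 * (r * (r - 1) / 2) = r * (r - 1) := by
      have := two_mul_triangular (r - 1)
      rwa [sub_add_cancel, mul_comm (r - 1)] at this
    have hrec : qPochRecip q ((l : ℤ) - j - r + r + j) = 1 / qPochR q q l := by
      rw [show (l : ℤ) - j - r + r + j = l by ring]
      simp [qPochRecip]
    have hk := two_mul_triangular ((l : ℤ) - j - r)
    have hl := two_mul_choose_two l
    have hj := two_mul_choose_two j
    have htp : t ^ ((l : ℤ) - j - r) * t ^ i * t ^ j = t ^ i * t ^ (-r) * t ^ l := by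
      simp only [← zpow_natCast, ← zpow_add₀ ht.ne']
      congr 1
      ring
    have hqp : q ^ (((l : ℤ) - j - r) * ((l : ℤ) - j - r + 1) / 2) *
        (q ^ ((l : ℤ) - j - r)) ^ i * q ^ (j ^ 2) * (q ^ ((l : ℤ) - j - r)) ^ j =
        q ^ (r * (r - 1) / 2 - i * r) * q ^ l.choose 2 * (q ^ (1 - r + (i : ℤ))) ^ l *
          q ^ j.choose 2 * (q ^ (-(i : ℤ))) ^ j := by
      simp only [← zpow_natCast, ← zpow_mul, ← zpow_add₀ hq0.ne']
      congr 1
      push_cast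
      refine mul_left_cancel₀ (two_ne_zero (α := ℤ)) ?_
      linear_combination hk - hr - hl - hj
    simp only [Function.comp, e, hrec]
    rw [neg_pow (q ^ (-(i : ℤ)))]
    simp only [mul_pow]
    calc _ = (t ^ ((l : ℤ) - j - r) * t ^ i * t ^ j) *
        (q ^ (((l : ℤ) - j - r) * ((l : ℤ) - j - r + 1) / 2) *
        (q ^ ((l : ℤ) - j - r)) ^ i * q ^ (j ^ 2) * (q ^ ((l : ℤ) - j - r)) ^ j) *
        ((-1) ^ j / qPochR q q j / qPochR q q l) := by ring
      _ = _ := by rw [htp, hqp]; ring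
  · rintro ⟨k, j⟩ hkj
    have : ¬ 0 ≤ k + r + j := fun h => hkj ⟨((k + r + j).toNat, j), by
      simp only [e, Int.toNat_of_nonneg h, Prod.mk.injEq, and_true]
      ring⟩
    simp [qPochRecip, this]

/-- The q-Bessel functions are orthogonal to all monomials. -/
lemma hasSum_monomial_mul_qBesselM {q : ℝ} (hq0 : 0 < q) (hq1 : q < 1) {t : ℝ} (ht : 0 < t)
    (i : ℕ) (r : ℤ) :
    HasSum (fun k : ℤ => t ^ k * q ^ (k * (k + 1) / 2) * (t * q ^ k) ^ i *
      qBesselM q t r (t * q ^ k)) 0 := by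
  have h := ((hasSum_double_series hq0 hq1 ht i r).mul_left (qEulerSeries q q)).prod_fiberwise
    (g := fun k : ℤ => t ^ k * q ^ (k * (k + 1) / 2) * (t * q ^ k) ^ i *
      phiSWR q (-q ^ r / t) (t * q ^ k)) fun k => by
        convert (hasSum_phiSWR_lattice hq0 hq1 ht r k).mul_left
          (t ^ k * q ^ (k * (k + 1) / 2) * (t * q ^ k) ^ i) using 2 with j
        ring
  simpa only [qBesselM, mul_div_assoc, mul_zero, zero_div] using h.div_const (qPochInfR q q)

theorem stieltjesWigert_qBesselM_orthogonality (q : ℝ) (hq0 : 0 < q) (hq1 : q < 1)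
    (t : ℝ) (ht : 0 < t) (n : ℕ) (r : ℤ) :
    (Summable fun k : ℤ =>
      |t ^ k * q ^ (k * (k + 1) / 2) *
        stieltjesWigertR q n (t * q ^ k) * qBesselM q t r (t * q ^ k)|) ∧
    ∑' k : ℤ, t ^ k * q ^ (k * (k + 1) / 2) *
        stieltjesWigertR q n (t * q ^ k) * qBesselM q t r (t * q ^ k) = 0 := by
  have h : HasSum (fun k : ℤ => t ^ k * q ^ (k * (k + 1) / 2) *
      stieltjesWigertR q n (t * q ^ k) * qBesselM q t r (t * q ^ k)) 0 := by
    have h := hasSum_sum (s := Finset.range (n + 1)) fun i _ =>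
      (hasSum_monomial_mul_qBesselM hq0 hq1 ht i r).mul_left ((1 / qPochR q q n) *
        ((qPochR q q n / (qPochR q q i * qPochR q q (n - i))) * (-1) ^ i * q ^ (i ^ 2)))
    simp only [mul_zero, Finset.sum_const_zero] at h
    refine Eq.subst (motive := fun f => HasSum f 0) (Eq.symm (funext fun k => ?_)) h
    simp only [stieltjesWigertR, Finset.mul_sum, Finset.sum_mul]
    refine Finset.sum_congr rfl fun i _ => ?_
    ring
  exact ⟨h.summable.abs, h.tsum_eq⟩
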